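/- arXiv:1607.00700 — 3 statements merged into one kernel-verified Lean document; each statement's English description precedes it below -/
import Mathlib

section
/- Let p ≥ 5 be a prime and let α be a p-integer. Then C(αp−1, p−1) ≡ 1 − α(α−1)(α²−α−1)·p·(∑_{k=1}^{p−1} 1/k) − (1/2)·α²(α−1)²·p²·(∑_{k=1}^{p−1} 1/k²) (mod p⁶). -/
open Finset

/-- A rational number is a `p`-integer if its `p`-adic valuation is nonnegative
(equivalently, its denominator is not divisible by `p`). -/
def IsPInteger (p : ℕ) (x : ℚ) : Prop := 0 ≤ padicValRat p x

/-- `a ≡ b (mod p^m)` for `p`-integers: `(a - b) / p^m` is a `p`-integer. -/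
def PModEq (p m : ℕ) (a b : ℚ) : Prop := IsPInteger p ((a - b) / (p : ℚ) ^ m)

/-- The generalized binomial coefficient `C(αp - 1, p - 1) = (∏_{k=1}^{p-1} (αp - k)) / (p-1)!`. -/
def genBinom (p : ℕ) (α : ℚ) : ℚ :=
  (∏ k ∈ Finset.Icc 1 (p - 1), (α * p - k)) / (Nat.factorial (p - 1) : ℚ)

/-- The ring of `p`-integers, as a subring of `ℚ`. -/
noncomputable def pIntegers (p : ℕ) [Fact p.Prime] : Subring ℚ :=
  (PadicInt.subring p).comap (Rat.castHom ℚ_[p])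

lemma mem_pIntegers_iff {p : ℕ} [Fact p.Prime] {x : ℚ} : x ∈ pIntegers p ↔ IsPInteger p x := by
  have hp : 1 < (p : ℝ) := by exact_mod_cast (Fact.out : p.Prime).one_lt
  change ‖(x : ℚ_[p])‖ ≤ 1 ↔ 0 ≤ padicValRat p x
  rcases eq_or_ne x 0 with rfl | hx
  · simp
  · rw [Padic.eq_padicNorm, padicNorm.eq_zpow_of_nonzero hx]
    push_cast
    rw [zpow_le_one_iff_right₀ hp]
    omega

lemma inv_natCast_mem_pIntegers {p : ℕ} [Fact p.Prime] {k : ℕ} (hk : ¬ p ∣ k) :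
    (k : ℚ)⁻¹ ∈ pIntegers p := by
  rw [mem_pIntegers_iff, IsPInteger, padicValRat.inv, padicValRat.of_nat,
    padicValNat.eq_zero_of_not_dvd hk]
  simp

@[to_additive]
lemma prod_Icc_pair_reflect {M : Type*} [CommMonoid M] (f : ℕ → M) (m : ℕ) :
    ∏ k ∈ Icc 1 (2 * m), f k = ∏ k ∈ Icc 1 m, f k * f (2 * m + 1 - k) := by
  have h : Icc 1 (2 * m) = Icc 1 m ∪ Icc (m + 1) (2 * m) := by
    ext k; simp only [mem_union, mem_Icc]; omega
  have hd : Disjoint (Icc 1 m) (Icc (m + 1) (2 * m)) := by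
    rw [Finset.disjoint_left]; intro k; simp only [mem_Icc]; omega
  rw [h, prod_union hd, prod_mul_distrib]
  congr 1
  refine prod_nbij' (fun k => 2 * m + 1 - k) (fun k => 2 * m + 1 - k) ?_ ?_ ?_ ?_ ?_
  all_goals intro k hk; simp only [mem_Icc] at hk ⊢
  iterate 4 omega
  congr 1; omega

/-- Expansion of `∏ (1 + t * u k)` up to third order in `t`. -/
lemma exists_prod_one_add_mul_eq {ι : Type*} (S : Subring ℚ) (h2 : (2 : ℚ)⁻¹ ∈ S)
    {t : ℚ} (ht : t ∈ S) (s : Finset ι) (u : ι → ℚ) (hu : ∀ i ∈ s, u i ∈ S) :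
    ∃ c ∈ S, ∏ i ∈ s, (1 + t * u i) = 1 + t * ∑ i ∈ s, u i
      + t ^ 2 * (2⁻¹ * ((∑ i ∈ s, u i) ^ 2 - ∑ i ∈ s, u i ^ 2)) + t ^ 3 * c := by
  classical
  induction s using Finset.induction_on with
  | empty => exact ⟨0, S.zero_mem, by simp⟩
  | insert a s ha ih =>
    have hs : ∀ i ∈ s, u i ∈ S := fun i hi => hu i (mem_insert_of_mem hi)
    have hua := hu a (mem_insert_self a s)
    obtain ⟨c, hc, h⟩ := ih hs
    refine ⟨c + 2⁻¹ * ((∑ i ∈ s, u i) ^ 2 - ∑ i ∈ s, u i ^ 2) * u a + c * t * u a, ?_, ?_⟩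
    · have h₁ := S.sum_mem hs
      have h₂ : ∑ i ∈ s, u i ^ 2 ∈ S := S.sum_mem fun i hi => S.pow_mem (hs i hi) 2
      exact S.add_mem (S.add_mem hc (S.mul_mem (S.mul_mem h2 (S.sub_mem (S.pow_mem h₁ 2) h₂)) hua))
        (S.mul_mem (S.mul_mem hc ht) hua)
    · rw [prod_insert ha, sum_insert ha, sum_insert ha, h]
      ring

lemma sum_Icc_inv_sq_zmod_eq_zero {p : ℕ} [Fact p.Prime] (hp5 : 5 ≤ p) :
    ∑ k ∈ Icc 1 (p - 1), ((k : ZMod p)⁻¹) ^ 2 = 0 := by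
  have hp : p.Prime := Fact.out
  have h : ∑ x : ZMod p, x ^ 2 = 0 :=
    FiniteField.sum_pow_lt_card_sub_one _ 2 (by rw [ZMod.card]; omega)
  have hinv : ∑ x : ZMod p, x⁻¹ ^ 2 = 0 :=
    (Equiv.sum_comp (Equiv.inv (ZMod p)) (fun x => x ^ 2)).trans h
  rw [← hinv, ← Finset.sum_subset (Finset.subset_univ (univ.erase (0 : ZMod p)))]
  · refine sum_nbij' (fun k => (k : ZMod p)) ZMod.val ?_ ?_ ?_ ?_ ?_
    · intro k hk
      rw [mem_Icc] at hk
      simp only [mem_erase, mem_univ, and_true, ne_eq, ZMod.natCast_eq_zero_iff]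
      exact fun hd => by have := Nat.le_of_dvd (by omega) hd; omega
    · intro x hx
      have := ZMod.val_lt x
      have : x.val ≠ 0 := by simpa [ZMod.val_eq_zero] using hx
      rw [mem_Icc]; omega
    · intro k hk
      rw [mem_Icc] at hk
      exact ZMod.val_natCast_of_lt (by omega)
    · intro x _
      exact ZMod.natCast_zmod_val x
    · intros; rfl
  · intro x _ hx
    have : x = 0 := by simpa using hx
    simp [this]

lemma exists_sum_inv_sq_eq_mul {p : ℕ} [Fact p.Prime] (hp5 : 5 ≤ p) :
    ∃ d ∈ pIntegers p, ∑ k ∈ Icc 1 (p - 1), (1 : ℚ) / k ^ 2 = p * d := by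
  have hp : p.Prime := Fact.out
  set F := (p - 1).factorial with hF
  have hpF : ¬ p ∣ F := by rw [hp.dvd_factorial]; omega
  have hF0 : (F : ℚ) ≠ 0 := by exact_mod_cast Nat.factorial_ne_zero _
  have hdvd : ∀ k ∈ Icc 1 (p - 1), k ∣ F := fun k hk => by
    rw [mem_Icc] at hk; exact Nat.dvd_factorial (by omega) hk.2
  have hN : p ∣ ∑ k ∈ Icc 1 (p - 1), (F / k) ^ 2 := by
    rw [← ZMod.natCast_eq_zero_iff]
    have : ((∑ k ∈ Icc 1 (p - 1), (F / k) ^ 2 : ℕ) : ZMod p)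
        = F ^ 2 * ∑ k ∈ Icc 1 (p - 1), ((k : ZMod p)⁻¹) ^ 2 := by
      rw [mul_sum]
      push_cast
      refine sum_congr rfl fun k hk => ?_
      have hk0 : (k : ZMod p) ≠ 0 := by
        rw [ne_eq, ZMod.natCast_eq_zero_iff]
        exact fun h => hpF (h.trans (hdvd k hk))
      rw [Nat.cast_div (hdvd k hk) hk0, div_eq_mul_inv, mul_pow]
    rw [this, sum_Icc_inv_sq_zmod_eq_zero hp5, mul_zero]
  obtain ⟨n, hn⟩ := hN
  have hnQ : ∑ k ∈ Icc 1 (p - 1), ((F : ℚ) / k) ^ 2 = p * n := by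
    rw [← Nat.cast_mul, ← hn]
    push_cast
    refine sum_congr rfl fun k hk => ?_
    have hk0 : (k : ℚ) ≠ 0 := by rw [mem_Icc] at hk; exact_mod_cast (by omega : k ≠ 0)
    rw [Nat.cast_div (hdvd k hk) hk0]
  refine ⟨n * (F : ℚ)⁻¹ ^ 2, mul_mem (natCast_mem _ n)
    (pow_mem (inv_natCast_mem_pIntegers hpF) 2), ?_⟩
  rw [← mul_assoc, ← hnQ, sum_mul]
  refine sum_congr rfl fun k _ => ?_
  field_simp

lemma genBinom_eq_prod (m : ℕ) (α : ℚ) :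
    genBinom (2 * m + 1) α = ∏ k ∈ Icc 1 m,
      (1 + α * (α - 1) * (2 * m + 1 : ℚ) ^ 2 * ((k : ℚ) * (2 * m + 1 - k))⁻¹) := by
  rw [genBinom, ← Finset.prod_Ico_id_eq_factorial, Ico_add_one_right_eq_Icc]
  push_cast
  rw [← prod_div_distrib, prod_Icc_pair_reflect]
  refine prod_congr rfl fun k hk => ?_
  rw [mem_Icc] at hk
  have hk0 : (k : ℚ) ≠ 0 := by exact_mod_cast (by omega : k ≠ 0)
  have hk1 : (2 * m + 1 - k : ℚ) ≠ 0 := by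
    have : (k : ℚ) ≤ m := by exact_mod_cast hk.2
    have : (0 : ℚ) ≤ m := by positivity
    linarith
  rw [Nat.cast_sub (by omega)]
  push_cast
  field_simp
  ring

theorem genBinom_mod_p6 (p : ℕ) (hp : p.Prime) (hp5 : 5 ≤ p)
    (α : ℚ) (hα : IsPInteger p α) :
    PModEq p 6 (genBinom p α)
      (1 - α * (α - 1) * (α ^ 2 - α - 1) * p * (∑ k ∈ Finset.Icc 1 (p - 1), (1 : ℚ) / k)
        - (1 / 2) * α ^ 2 * (α - 1) ^ 2 * p ^ 2 *
          (∑ k ∈ Finset.Icc 1 (p - 1), (1 : ℚ) / (k ^ 2))) := by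
  have : Fact p.Prime := ⟨hp⟩
  obtain ⟨d, hd, hH2⟩ := exists_sum_inv_sq_eq_mul hp5
  rw [PModEq, ← mem_pIntegers_iff]
  rw [← mem_pIntegers_iff] at hα
  obtain ⟨m, hm⟩ : ∃ m, p = 2 * m + 1 := hp.odd_of_ne_two (by omega)
  have hpm : (p : ℚ) = 2 * m + 1 := by rw [hm]; push_cast; ring
  have hp0 : (p : ℚ) ≠ 0 := by exact_mod_cast hp.ne_zero
  have h2 : (2 : ℚ)⁻¹ ∈ pIntegers p := by
    exact_mod_cast inv_natCast_mem_pIntegers (p := p) (k := 2)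
      (fun h => by have := Nat.le_of_dvd (by omega) h; omega)
  have hpmem : (p : ℚ) ∈ pIntegers p := natCast_mem _ p
  have hβ : α * (α - 1) ∈ pIntegers p := mul_mem hα (sub_mem hα (one_mem _))
  set u : ℕ → ℚ := fun k => ((k : ℚ) * (p - k))⁻¹ with hu_def
  have hu : ∀ k ∈ Icc 1 m, u k ∈ pIntegers p := fun k hk => by
    rw [mem_Icc] at hk
    have : u k = ((k * (p - k) : ℕ) : ℚ)⁻¹ := by
      rw [Nat.cast_mul, Nat.cast_sub (by omega)]
    rw [this]
    refine inv_natCast_mem_pIntegers fun h => ?_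
    rcases hp.dvd_mul.1 h with h | h <;> have := Nat.le_of_dvd (by omega) h <;> omega
  have hne : ∀ k ∈ Icc 1 m, (k : ℚ) ≠ 0 ∧ (p - k : ℚ) ≠ 0 ∧
      ((2 * m + 1 - k : ℕ) : ℚ) = p - k := fun k hk => by
    rw [mem_Icc] at hk
    rw [← hm, ← Nat.cast_sub (by omega : k ≤ p)]
    exact ⟨by exact_mod_cast (by omega : k ≠ 0), by exact_mod_cast (by omega : p - k ≠ 0), rfl⟩
  obtain ⟨c, hc, hprod⟩ := exists_prod_one_add_mul_eq (pIntegers p) h2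
    (mul_mem hβ (pow_mem hpmem 2)) (Icc 1 m) u hu
  have hgen : genBinom p α = ∏ k ∈ Icc 1 m, (1 + α * (α - 1) * (p : ℚ) ^ 2 * u k) := by
    simp only [hu_def, hpm]
    rw [← genBinom_eq_prod, hm]
  have hIcc : Icc 1 (p - 1) = Icc 1 (2 * m) := by rw [hm, Nat.add_sub_cancel]
  have hH1 : ∑ k ∈ Icc 1 (p - 1), (1 : ℚ) / k = p * ∑ k ∈ Icc 1 m, u k := by
    rw [hIcc, sum_Icc_pair_reflect, mul_sum]
    refine sum_congr rfl fun k hk => ?_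
    obtain ⟨h₀, h₁, h₂⟩ := hne k hk
    rw [h₂]
    simp only [hu_def]
    field_simp
    ring
  have hH2' : ∑ k ∈ Icc 1 (p - 1), (1 : ℚ) / k ^ 2
      = p ^ 2 * ∑ k ∈ Icc 1 m, u k ^ 2 - 2 * ∑ k ∈ Icc 1 m, u k := by
    rw [hIcc, sum_Icc_pair_reflect, mul_sum, mul_sum, ← sum_sub_distrib]
    refine sum_congr rfl fun k hk => ?_
    obtain ⟨h₀, h₁, h₂⟩ := hne k hk
    rw [h₂]
    simp only [hu_def]
    field_simp
    ring
  have hS2 : ∑ k ∈ Icc 1 m, u k ^ 2 ∈ pIntegers p := sum_mem fun k hk => pow_mem (hu k hk) 2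
  rw [hgen, hprod, hH1, hH2']
  set E := ∑ k ∈ Icc 1 m, u k
  set S := ∑ k ∈ Icc 1 m, u k ^ 2
  have hE : E = p * (2⁻¹ * (p * S - d)) := by linear_combination (hH2' - hH2) / 2
  have hw : 2⁻¹ * (p * S - d) ∈ pIntegers p := mul_mem h2 (sub_mem (mul_mem hpmem hS2) hd)
  generalize 2⁻¹ * (p * S - d) = w at hE hw
  have hquot : 2⁻¹ * (α * (α - 1)) ^ 2 * w ^ 2 + (α * (α - 1)) ^ 3 * c ∈ pIntegers p :=
    add_mem (mul_mem (mul_mem h2 (pow_mem hβ 2)) (pow_mem hw 2)) (mul_mem (pow_mem hβ 3) hc)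
  convert hquot using 1
  rw [hE, div_eq_iff (pow_ne_zero 6 hp0)]
  ring
end

section
/- Let p ≥ 7 be a prime. Then (−1)^{(p−1)/2}·C(p−1, (p−1)/2) ≡ 4^{p−1}·(1 − (1/4)·p·(∑_{k=1}^{p−1} 1/k)) (mod p⁵), where C(p−1, (p−1)/2) denotes the central binomial coefficient. -/
open Finset

/-- Pairing `k` with `2n + 1 - k` in a product over `1 ≤ k ≤ 2n`. -/
theorem prod_Icc_two_mul_eq_prod_pairs {M : Type*} [CommMonoid M] (f : ℕ → M) (n : ℕ) :
    ∏ k ∈ Icc 1 (2 * n), f k = ∏ j ∈ range n, f (j + 1) * f (2 * n - j) := by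
  have hIcc : ∏ k ∈ Icc 1 (2 * n), f k = ∏ k ∈ range (2 * n), f (k + 1) := by
    rw [range_eq_Ico, prod_Ico_add' f 0 (2 * n) 1]
    rfl
  rw [hIcc, two_mul, prod_range_add, prod_mul_distrib,
    ← prod_range_reflect (fun k => f (n + k + 1)) n]
  congr 1
  refine prod_congr rfl fun j hj => ?_
  have := mem_range.1 hj
  congr 1
  lia

/-- Pairing `k` with `2n + 1 - k` in a sum over `1 ≤ k ≤ 2n`. -/
theorem sum_Icc_two_mul_eq_sum_pairs {M : Type*} [AddCommMonoid M] (f : ℕ → M) (n : ℕ) :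
    ∑ k ∈ Icc 1 (2 * n), f k = ∑ j ∈ range n, (f (j + 1) + f (2 * n - j)) :=
  prod_Icc_two_mul_eq_prod_pairs (M := Multiplicative M) f n

/-- A product of odd numbers expressed through factorials. -/
theorem prod_odd_mul_two_pow_mul_factorial (n : ℕ) :
    (∏ j ∈ range n, (2 * j + 1)) * (2 ^ n * n.factorial) = (2 * n).factorial := by
  induction n with
  | zero => simp
  | succ n ih =>
    rw [prod_range_succ, show 2 * (n + 1) = 2 * n + 1 + 1 by ring, Nat.factorial_succ (2 * n + 1),
      Nat.factorial_succ (2 * n), Nat.factorial_succ n, ← ih]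
    ring

/-- An exact product formula for the central binomial coefficient. -/
theorem neg_one_pow_mul_choose_eq_prod (n : ℕ) :
    (-1 : ℚ) ^ n * ((2 * n).choose n : ℚ) =
      4 ^ (2 * n) * ∏ j ∈ range n,
        (1 - (2 * n + 1 : ℚ) ^ 2 * (4 * (j + 1) * (2 * n - j) : ℚ)⁻¹) := by
  have hfactor : ∀ j ∈ range n,
      (1 - (2 * n + 1 : ℚ) ^ 2 * (4 * (j + 1) * (2 * n - j) : ℚ)⁻¹) =
        (-1) * (2 * (n - 1 - j : ℕ) + 1 : ℚ) ^ 2 * (4 * (((j + 1 : ℕ) : ℚ) * (2 * n - j : ℕ)))⁻¹ := by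
    intro j hj
    have hj' := mem_range.1 hj
    have h1 : ((n - 1 - j : ℕ) : ℚ) = n - 1 - j := by
      rw [Nat.cast_sub (by lia), Nat.cast_sub (by lia)]
      simp
    have h2 : ((2 * n - j : ℕ) : ℚ) = 2 * n - j := by
      rw [Nat.cast_sub (by lia)]
      simp
    have h3 : (2 * n - j : ℚ) ≠ 0 := by
      rw [← h2]
      exact_mod_cast (by lia : 2 * n - j ≠ 0)
    have h4 : (j + 1 : ℚ) ≠ 0 := by positivity
    rw [h1, h2]
    push_cast
    field_simp
    ring
  have hodd : ∏ j ∈ range n, (2 * (n - 1 - j : ℕ) + 1 : ℚ) = ∏ j ∈ range n, (2 * (j : ℚ) + 1) :=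
    prod_range_reflect (fun j => (2 * (j : ℚ) + 1)) n
  have hfact : ∏ j ∈ range n, (((j + 1 : ℕ) : ℚ) * (2 * n - j : ℕ)) = (2 * n).factorial := by
    rw [← prod_Icc_two_mul_eq_prod_pairs (fun k => (k : ℚ)) n]
    rw [← prod_Ico_id_eq_factorial, Nat.cast_prod]
    rfl
  have hdouble : (∏ j ∈ range n, (2 * (j : ℚ) + 1)) * (2 ^ n * n.factorial) =
      (2 * n).factorial := by
    exact_mod_cast prod_odd_mul_two_pow_mul_factorial n
  have hchoose : ((2 * n).choose n : ℚ) * n.factorial * n.factorial = (2 * n).factorial := by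
    have := Nat.choose_mul_factorial_mul_factorial (show n ≤ 2 * n by lia)
    rw [show 2 * n - n = n by lia] at this
    exact_mod_cast this
  have hn : (n.factorial : ℚ) ≠ 0 := by positivity
  have h2n : ((2 * n).factorial : ℚ) ≠ 0 := by positivity
  rw [prod_congr rfl hfactor, prod_mul_distrib, prod_mul_distrib, prod_pow, prod_inv_distrib,
    prod_mul_distrib, hodd, hfact, prod_const, prod_const, card_range]
  generalize ∏ j ∈ range n, (2 * (j : ℚ) + 1) = d at hdouble
  have hd : d = (2 * n).factorial / (2 ^ n * n.factorial) := by
    rw [← hdouble]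
    field_simp
  have hc : ((2 * n).choose n : ℚ) = (2 * n).factorial / (n.factorial * n.factorial) := by
    rw [← hchoose]
    field_simp
  have h4 : (4 : ℚ) ^ n = 2 ^ n * 2 ^ n := by
    rw [← mul_pow]
    norm_num
  rw [hd, hc, pow_mul', h4]
  field_simp

/-- Twice the expansion of `∏ (1 - x bⱼ)` to second order in `x`, via power sums. -/
theorem exists_two_mul_prod_one_sub_mul_eq {ι R : Type*} [CommRing R] (s : Finset ι) (x : R)
    (b : ι → R) :
    ∃ c, 2 * ∏ j ∈ s, (1 - x * b j) =
      2 - 2 * x * ∑ j ∈ s, b j + x ^ 2 * ((∑ j ∈ s, b j) ^ 2 - ∑ j ∈ s, b j ^ 2) + x ^ 3 * c := by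
  classical
  induction s using Finset.induction_on with
  | empty => exact ⟨0, by simp⟩
  | insert a s ha ih =>
    obtain ⟨c, hc⟩ := ih
    rw [prod_insert ha, sum_insert ha, sum_insert ha]
    refine ⟨c - b a * ((∑ j ∈ s, b j) ^ 2 - ∑ j ∈ s, b j ^ 2) - x * b a * c, ?_⟩
    linear_combination (1 - x * b a) * hc

/-- Sums of small even negative powers over half of the nonzero residues modulo an odd prime
vanish. -/
theorem ZMod.sum_range_half_inv_pow_eq_zero (n i : ℕ) [Fact (2 * n + 1).Prime] (hi : Even i)
    (hi0 : i ≠ 0) (hin : i < 2 * n) :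
    ∑ j ∈ range n, (((j + 1 : ℕ) : ZMod (2 * n + 1))⁻¹) ^ i = 0 := by
  set p := 2 * n + 1 with hp
  have hfull : ∑ x : ZMod p, (x⁻¹) ^ i = 0 := by
    refine (Equiv.sum_comp (Equiv.inv (ZMod p)) (fun x => x ^ i)).trans ?_
    exact FiniteField.sum_pow_lt_card_sub_one (ZMod p) i (by rw [ZMod.card]; lia)
  have hrange : ∑ k ∈ range p, ((k : ZMod p)⁻¹) ^ i = ∑ x : ZMod p, (x⁻¹) ^ i := by
    refine sum_nbij' (fun k => (k : ZMod p)) ZMod.val (by simp) ?_ ?_ (by simp) (by simp)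
    · exact fun x _ => mem_range.2 x.val_lt
    · exact fun k hk => ZMod.val_cast_of_lt (mem_range.1 hk)
  have hIcc : ∑ k ∈ range p, ((k : ZMod p)⁻¹) ^ i =
      ∑ k ∈ Icc 1 (2 * n), ((k : ZMod p)⁻¹) ^ i := by
    rw [show range p = range (2 * n + 1) from rfl, sum_range_succ', range_eq_Ico,
      sum_Ico_add' (fun k : ℕ => ((k : ZMod p)⁻¹) ^ i) 0 (2 * n) 1]
    simp only [Nat.cast_zero, inv_zero, zero_pow hi0, add_zero]
    rfl
  have hpair : ∀ j ∈ range n, (((j + 1 : ℕ) : ZMod p)⁻¹) ^ i + (((2 * n - j : ℕ) : ZMod p)⁻¹) ^ i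
      = 2 * (((j + 1 : ℕ) : ZMod p)⁻¹) ^ i := by
    intro j hj
    have hj' := mem_range.1 hj
    have hneg : ((2 * n - j : ℕ) : ZMod p) = -((j + 1 : ℕ) : ZMod p) := by
      rw [eq_neg_iff_add_eq_zero, ← Nat.cast_add, show 2 * n - j + (j + 1) = p by lia,
        ZMod.natCast_self]
    rw [hneg, inv_neg, hi.neg_pow, two_mul]
  rw [← hrange, hIcc, sum_Icc_two_mul_eq_sum_pairs, sum_congr rfl hpair, ← mul_sum] at hfull
  refine (mul_eq_zero.1 hfull).resolve_left fun h2 => ?_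
  have h2' : ((2 : ℕ) : ZMod p) = 0 := by exact_mod_cast h2
  have := Nat.le_of_dvd two_pos ((ZMod.natCast_eq_zero_iff 2 p).1 h2')
  lia

theorem PadicInt.toZMod_eq_zero_iff_dvd {p : ℕ} [Fact p.Prime] (x : ℤ_[p]) :
    PadicInt.toZMod x = 0 ↔ (p : ℤ_[p]) ∣ x := by
  rw [← RingHom.mem_ker, PadicInt.ker_toZMod, PadicInt.maximalIdeal_eq_span_p,
    Ideal.mem_span_singleton]

theorem PadicInt.coe_prod {ι : Type*} {p : ℕ} [Fact p.Prime] (s : Finset ι) (f : ι → ℤ_[p]) :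
    ((∏ j ∈ s, f j : ℤ_[p]) : ℚ_[p]) = ∏ j ∈ s, (f j : ℚ_[p]) :=
  map_prod PadicInt.Coe.ringHom f s

theorem PadicInt.isUnit_natCast_of_not_dvd {p k : ℕ} [hp : Fact p.Prime] (hk : ¬p ∣ k) :
    IsUnit (k : ℤ_[p]) := by
  rw [PadicInt.isUnit_iff, PadicInt.norm_natCast_eq_one_iff]
  exact (Nat.Prime.coprime_iff_not_dvd hp.out).2 hk

/-- If the power sums of `b` of order one and two are divisible by `p`, then the product
`∏ (1 - p² bⱼ)` is linear modulo `p⁵`. -/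
theorem PadicInt.pow_five_dvd_prod_one_sub {ι : Type*} {p : ℕ} [hp : Fact p.Prime] (hp2 : p ≠ 2)
    (s : Finset ι) (b : ι → ℤ_[p]) (h1 : (p : ℤ_[p]) ∣ ∑ j ∈ s, b j)
    (h2 : (p : ℤ_[p]) ∣ ∑ j ∈ s, b j ^ 2) :
    (p : ℤ_[p]) ^ 5 ∣ ∏ j ∈ s, (1 - (p : ℤ_[p]) ^ 2 * b j) - (1 - p ^ 2 * ∑ j ∈ s, b j) := by
  obtain ⟨c, hc⟩ := exists_two_mul_prod_one_sub_mul_eq s ((p : ℤ_[p]) ^ 2) b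
  have hunit : IsUnit (2 : ℤ_[p]) := by
    refine mod_cast PadicInt.isUnit_natCast_of_not_dvd (p := p) (k := 2) fun h => hp2 ?_
    exact (Nat.prime_dvd_prime_iff_eq hp.out Nat.prime_two).1 h
  rw [← hunit.dvd_mul_left, mul_sub, hc]
  obtain ⟨u, hu⟩ := h1
  obtain ⟨v, hv⟩ := h2
  rw [hu, hv]
  exact ⟨p * u ^ 2 - v + p * c, by ring⟩

theorem isPInteger_of_norm_le_one {p : ℕ} [Fact p.Prime] {q : ℚ} (hq : ‖(q : ℚ_[p])‖ ≤ 1) :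
    IsPInteger p q := by
  rcases eq_or_ne q 0 with rfl | hq0
  · simp [IsPInteger]
  rw [Padic.eq_padicNorm, padicNorm.eq_zpow_of_nonzero hq0] at hq
  push_cast at hq
  have h1 : (1 : ℝ) < p := mod_cast (Fact.out : p.Prime).one_lt
  have := (zpow_le_one_iff_right₀ h1).1 hq
  unfold IsPInteger
  lia

/-- A congruence of rationals can be checked in the `p`-adic integers. -/
theorem pModEq_of_padicInt {p m : ℕ} [hp : Fact p.Prime] {a b : ℚ} {z : ℤ_[p]}
    (hz : (p : ℤ_[p]) ^ m ∣ z) (hab : ((a - b : ℚ) : ℚ_[p]) = z) : PModEq p m a b := by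
  obtain ⟨w, rfl⟩ := hz
  refine isPInteger_of_norm_le_one (p := p) ?_
  have hp0 : (p : ℚ_[p]) ≠ 0 := mod_cast hp.out.ne_zero
  rw [Rat.cast_div, hab]
  push_cast
  rw [mul_div_cancel_left₀ _ (pow_ne_zero m hp0)]
  exact w.2

/-- The harmonic sum `H_{2n}` in terms of products of paired denominators. -/
theorem quarter_mul_harmonic_eq (n : ℕ) :
    (1 / 4 : ℚ) * (2 * n + 1) * ∑ k ∈ Icc 1 (2 * n), (1 : ℚ) / k =
      (2 * n + 1) ^ 2 * ∑ j ∈ range n, (4 * (j + 1) * (2 * n - j) : ℚ)⁻¹ := by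
  rw [sum_Icc_two_mul_eq_sum_pairs, mul_sum, mul_sum]
  refine sum_congr rfl fun j hj => ?_
  have hj' := mem_range.1 hj
  have h2 : ((2 * n - j : ℕ) : ℚ) = 2 * n - j := by
    rw [Nat.cast_sub (by lia)]
    simp
  have h3 : (2 * n - j : ℚ) ≠ 0 := by
    rw [← h2]
    exact_mod_cast (by lia : 2 * n - j ≠ 0)
  have h4 : (j + 1 : ℚ) ≠ 0 := by positivity
  rw [h2]
  push_cast
  field_simp
  ring

theorem central_binom_harmonic_mod_p5 (p : ℕ) (hp : p.Prime) (hp7 : 7 ≤ p) :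
    PModEq p 5
      ((-1 : ℚ) ^ ((p - 1) / 2) * (Nat.choose (p - 1) ((p - 1) / 2) : ℚ))
      ((4 : ℚ) ^ (p - 1) *
        (1 - (1 / 4) * p * (∑ k ∈ Finset.Icc 1 (p - 1), (1 : ℚ) / k))) := by
  obtain ⟨n, rfl⟩ := hp.odd_of_ne_two (by lia)
  have : Fact (2 * n + 1).Prime := ⟨hp⟩
  rw [show 2 * n + 1 - 1 = 2 * n by lia, show 2 * n / 2 = n by lia]
  set p := 2 * n + 1 with hpn
  set d : ℕ → ℤ_[p] := fun j => ((4 * (j + 1) * (2 * n - j) : ℕ) : ℤ_[p]) with hd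
  have hunit : ∀ j ∈ range n, IsUnit (d j) := by
    intro j hj
    have hj' := mem_range.1 hj
    refine PadicInt.isUnit_natCast_of_not_dvd fun h => ?_
    rcases (hp.dvd_mul).1 h with h | h
    · rcases (hp.dvd_mul).1 h with h | h
      · exact absurd (Nat.le_of_dvd (by lia) h) (by lia)
      · exact absurd (Nat.le_of_dvd (by lia) h) (by lia)
    · exact absurd (Nat.le_of_dvd (by lia) h) (by lia)
  set b : ℕ → ℤ_[p] := fun j => Ring.inverse (d j) with hb
  have hdb : ∀ j ∈ range n, d j * b j = 1 := fun j hj => Ring.mul_inverse_cancel _ (hunit j hj)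
  have hcoe : ∀ j ∈ range n, (b j : ℚ_[p]) = (((4 * (j + 1) * (2 * n - j) : ℚ)⁻¹ : ℚ) : ℚ_[p]) := by
    intro j hj
    have h := congrArg (fun z : ℤ_[p] => (z : ℚ_[p])) (hdb j hj)
    simp only [hd, PadicInt.coe_mul, PadicInt.coe_natCast, PadicInt.coe_one] at h
    rw [eq_inv_of_mul_eq_one_right h, Nat.cast_mul, Nat.cast_sub (by have := mem_range.1 hj; lia)]
    push_cast
    rfl
  have hmod : ∀ j ∈ range n,
      PadicInt.toZMod (b j) = -(4 : ZMod p)⁻¹ * (((j + 1 : ℕ) : ZMod p)⁻¹) ^ 2 := by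
    intro j hj
    have hneg : ((2 * n - j : ℕ) : ZMod p) = -((j + 1 : ℕ) : ZMod p) := by
      rw [eq_neg_iff_add_eq_zero, ← Nat.cast_add,
        show 2 * n - j + (j + 1) = p by have := mem_range.1 hj; lia, ZMod.natCast_self]
    have h := congrArg (PadicInt.toZMod (p := p)) (hdb j hj)
    rw [map_mul, map_one, hd, map_natCast, Nat.cast_mul, hneg, Nat.cast_mul] at h
    rw [eq_inv_of_mul_eq_one_right h, mul_neg, inv_neg, mul_inv, mul_inv]
    push_cast
    ring
  have h1 : (p : ℤ_[p]) ∣ ∑ j ∈ range n, b j := by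
    rw [← PadicInt.toZMod_eq_zero_iff_dvd, map_sum, sum_congr rfl hmod, ← mul_sum,
      ZMod.sum_range_half_inv_pow_eq_zero n 2 even_two two_ne_zero (by lia), mul_zero]
  have h2 : (p : ℤ_[p]) ∣ ∑ j ∈ range n, b j ^ 2 := by
    have hsq : ∀ j ∈ range n, PadicInt.toZMod (b j ^ 2) =
        (-(4 : ZMod p)⁻¹) ^ 2 * (((j + 1 : ℕ) : ZMod p)⁻¹) ^ 4 := by
      intro j hj
      rw [map_pow, hmod j hj]
      ring
    rw [← PadicInt.toZMod_eq_zero_iff_dvd, map_sum, sum_congr rfl hsq, ← mul_sum,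
      ZMod.sum_range_half_inv_pow_eq_zero n 4 (by decide) four_ne_zero (by lia), mul_zero]
  have hdvd := PadicInt.pow_five_dvd_prod_one_sub (by lia) (range n) b h1 h2
  refine pModEq_of_padicInt (hdvd.mul_left ((4 : ℤ_[p]) ^ (2 * n))) ?_
  have hpQ : (p : ℚ) = 2 * n + 1 := by simp [hpn]
  rw [neg_one_pow_mul_choose_eq_prod, hpQ, quarter_mul_harmonic_eq, ← hpQ, ← mul_sub]
  have hprod : ((∏ j ∈ range n, (1 - (p : ℤ_[p]) ^ 2 * b j) : ℤ_[p]) : ℚ_[p]) =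
      ∏ j ∈ range n, (1 - (p : ℚ_[p]) ^ 2 * (b j : ℚ_[p])) := by
    rw [PadicInt.coe_prod]
    push_cast
    rfl
  have hfour : ((4 : ℤ_[p]) : ℚ_[p]) = 4 := rfl
  rw [PadicInt.coe_mul, PadicInt.coe_sub, hprod, PadicInt.coe_sub, PadicInt.coe_mul,
    PadicInt.coe_sum, sum_congr rfl hcoe,
    prod_congr rfl fun j hj => congrArg (fun z => 1 - (p : ℚ_[p]) ^ 2 * z) (hcoe j hj)]
  push_cast [hfour]
  rfl
end

section
/- Let p be an odd prime and let m ≥ 1 be an integer with 2m+1 ≠ p−2. Then H_{2m−1} − m·p·H_{2m} ≡ 0 (mod p⁴), i.e., the p-adic valuation of H_{2m−1} − m·p·H_{2m} is at least 4. -/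
open Finset

/-- `H p m` : the `m`-th elementary symmetric function of `1/1, 1/2, …, 1/(p-1)`.
By convention `H p 0 = 1` and `H p m = 0` for `m ≥ p`. -/
def H (p m : ℕ) : ℚ :=
  ∑ t ∈ (Finset.Icc 1 (p - 1)).powersetCard m, ∏ k ∈ t, (1 : ℚ) / k

/-- The polynomial `(X + 1) (X + 2) ⋯ (X + (p - 1))` with integer coefficients. -/
noncomputable def risingProd (p : ℕ) : Polynomial ℤ :=
  ∏ k ∈ Icc 1 (p - 1), (Polynomial.X + Polynomial.C (k : ℤ))

theorem coeff_prod_one_add_C_mul_X {ι R : Type*} [CommSemiring R] (s : Finset ι) (a : ι → R)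
    (m : ℕ) :
    (∏ k ∈ s, (1 + Polynomial.C (a k) * Polynomial.X)).coeff m =
      ∑ t ∈ s.powersetCard m, ∏ k ∈ t, a k := by
  rw [Finset.prod_one_add, Polynomial.finsetSum_coeff, Finset.powersetCard_eq_filter,
    Finset.sum_filter]
  refine Finset.sum_congr rfl fun t _ => ?_
  rw [Finset.prod_mul_distrib, Finset.prod_const, ← map_prod, Polynomial.coeff_C_mul_X_pow]
  simp only [eq_comm]

theorem coeff_risingProd (p m : ℕ) :
    ((risingProd p).coeff m : ℚ) = (p - 1).factorial * H p m := by
  have h : (risingProd p).map (Int.castRingHom ℚ) = Polynomial.C ((p - 1).factorial : ℚ) *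
      ∏ k ∈ Icc 1 (p - 1), (1 + Polynomial.C ((1 : ℚ) / k) * Polynomial.X) := by
    rw [risingProd, Polynomial.map_prod, ← Finset.prod_Ico_id_eq_factorial,
      Finset.Ico_add_one_right_eq_Icc, Nat.cast_prod, map_prod, ← Finset.prod_mul_distrib]
    refine Finset.prod_congr rfl fun k hk => ?_
    have hk0 : (k : ℚ) ≠ 0 := by
      have := (Finset.mem_Icc.1 hk).1
      positivity
    rw [mul_add, ← mul_assoc, ← Polynomial.C_mul, mul_one_div_cancel hk0]
    simp [add_comm]
  have h' := congrArg (fun f => Polynomial.coeff f m) h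
  simpa only [Polynomial.coeff_map, Polynomial.coeff_C_mul, coeff_prod_one_add_C_mul_X,
    eq_intCast, H] using h'

theorem map_risingProd_zmod (p : ℕ) [hp : Fact p.Prime] :
    (risingProd p).map (Int.castRingHom (ZMod p)) = Polynomial.X ^ (p - 1) - 1 := by
  have hp1 := hp.out.one_lt
  have hF : (risingProd p).map (Int.castRingHom (ZMod p)) =
      ∏ k ∈ Icc 1 (p - 1), (Polynomial.X + Polynomial.C (k : ZMod p)) := by
    simp [risingProd, Polynomial.map_prod]
  have hmon : (∏ k ∈ Icc 1 (p - 1), (Polynomial.X + Polynomial.C (k : ZMod p))).Monic :=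
    Polynomial.monic_prod_of_monic _ _ fun k _ => Polynomial.monic_X_add_C _
  have hdeg : (∏ k ∈ Icc 1 (p - 1), (Polynomial.X + Polynomial.C (k : ZMod p))).degree =
      ((p - 1 : ℕ) : WithBot ℕ) := by
    rw [Polynomial.degree_prod, Finset.sum_congr rfl fun k _ => Polynomial.degree_X_add_C _]
    simp
  have hdeg' : (Polynomial.X ^ (p - 1) - 1 : Polynomial (ZMod p)).degree =
      ((p - 1 : ℕ) : WithBot ℕ) := by
    simpa using Polynomial.degree_X_pow_sub_C (by omega : 0 < p - 1) (1 : ZMod p)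
  have hmon' : (Polynomial.X ^ (p - 1) - 1 : Polynomial (ZMod p)).Monic := by
    simpa using Polynomial.monic_X_pow_sub_C (1 : ZMod p) (by omega : p - 1 ≠ 0)
  rw [hF]
  refine Polynomial.eq_of_degree_sub_lt_of_eval_finset_eq (univ.erase (0 : ZMod p)) ?_ ?_
  · rw [Finset.card_erase_of_mem (mem_univ _), Finset.card_univ, ZMod.card, ← hdeg]
    exact Polynomial.degree_sub_lt_left (hdeg.trans hdeg'.symm) hmon.ne_zero
      (hmon.leadingCoeff.trans hmon'.leadingCoeff.symm)
  · intro x hx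
    have hx0 : x ≠ 0 := Finset.ne_of_mem_erase hx
    rw [Polynomial.eval_prod, Finset.prod_eq_zero (i := (-x).val)]
    · simp [ZMod.pow_card_sub_one_eq_one hx0]
    · have h1 := ZMod.val_lt (-x)
      have h2 : (-x).val ≠ 0 := by simpa using hx0
      rw [Finset.mem_Icc]
      omega
    · simp

theorem prime_dvd_coeff_risingProd {p j : ℕ} (hp : p.Prime) (hj : j ≠ 0) (hj' : j ≠ p - 1) :
    (p : ℤ) ∣ (risingProd p).coeff j := by
  have := Fact.mk hp
  have h := congrArg (fun f => Polynomial.coeff f j) (map_risingProd_zmod p)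
  rw [← ZMod.intCast_zmod_eq_zero_iff_dvd]
  simpa [Polynomial.coeff_map, Polynomial.coeff_X_pow, Polynomial.coeff_one, hj, hj'] using h

theorem taylor_risingProd_comp_neg_X {p : ℕ} (hodd : Odd p) :
    Polynomial.taylor (p : ℤ) ((risingProd p).comp (-Polynomial.X)) = risingProd p := by
  have hp := hodd.pos
  have heven : Even (p - 1) := Nat.Odd.sub_odd hodd odd_one
  rw [Polynomial.taylor_apply, Polynomial.comp_assoc, risingProd, Polynomial.prod_comp]
  have h : ∀ k ∈ Icc 1 (p - 1), ((Polynomial.X + Polynomial.C (k : ℤ)).comp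
      ((-Polynomial.X : Polynomial ℤ).comp (Polynomial.X + Polynomial.C (p : ℤ)))) =
      -(Polynomial.X + Polynomial.C ((p - k : ℕ) : ℤ)) := by
    intro k hk
    have := (Finset.mem_Icc.1 hk).2
    rw [Nat.cast_sub (by omega)]
    simp
    ring
  rw [Finset.prod_congr rfl h, Finset.prod_neg, Nat.card_Icc, Nat.add_sub_cancel,
    heven.neg_one_pow, one_mul]
  refine Finset.prod_nbij' (fun k => p - k) (fun k => p - k) ?_ ?_ ?_ ?_ fun _ _ => rfl <;>
  · intro k hk
    simp only [Finset.mem_Icc] at hk ⊢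
    omega

theorem exists_eval_eq_truncation {R : Type*} [CommRing R] (f : Polynomial R) (x : R) :
    ∃ q, f.eval x = f.coeff 0 + f.coeff 1 * x + f.coeff 2 * x ^ 2 + f.coeff 3 * x ^ 3 +
      q * x ^ 4 := by
  have key (g : Polynomial R) : g.eval x = g.divX.eval x * x + g.coeff 0 := by
    conv_lhs => rw [← g.divX_mul_X_add]
    simp
  refine ⟨f.divX.divX.divX.divX.eval x, ?_⟩
  rw [key f, key f.divX, key f.divX.divX, key f.divX.divX.divX]
  simp only [Polynomial.coeff_divX]
  ring

theorem coeff_comp_neg_X {R : Type*} [CommRing R] (f : Polynomial R) (n : ℕ) :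
    (f.comp (-Polynomial.X)).coeff n = (-1) ^ n * f.coeff n := by
  have h : (-Polynomial.X : Polynomial R) = Polynomial.C (-1) * Polynomial.X := by simp
  rw [h, Polynomial.comp_C_mul_X_coeff, mul_comm]

theorem exists_two_mul_coeff_risingProd {p n : ℕ} (hodd : Odd p) (hn : Odd n) :
    ∃ a b q : ℤ, 2 * (risingProd p).coeff n = (n + 1) * p * (risingProd p).coeff (n + 1) +
      p ^ 2 * (a * (risingProd p).coeff (n + 2)) + p ^ 3 * (b * (risingProd p).coeff (n + 3)) +
      p ^ 4 * q := by
  obtain ⟨q, hq⟩ := exists_eval_eq_truncation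
    (Polynomial.hasseDeriv n ((risingProd p).comp (-Polynomial.X))) (p : ℤ)
  rw [← Polynomial.taylor_coeff, taylor_risingProd_comp_neg_X hodd] at hq
  simp only [Polynomial.hasseDeriv_coeff, coeff_comp_neg_X, pow_add,
    hn.neg_one_pow, add_zero, Nat.choose_self, add_comm _ n, Nat.choose_succ_self_right] at hq
  refine ⟨-(n + 2).choose n, (n + 3).choose n, q, ?_⟩
  push_cast at hq ⊢
  linear_combination hq

theorem prime_pow_four_dvd_coeff_risingProd {p m : ℕ} (hp : p.Prime) (hodd : Odd p)
    (hm : 1 ≤ m) (hm' : 2 * m + 1 ≠ p - 2) :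
    (p : ℤ) ^ 4 ∣ (risingProd p).coeff (2 * m - 1) - m * p * (risingProd p).coeff (2 * m) := by
  obtain ⟨n, rfl⟩ : ∃ n, m = n + 1 := ⟨m - 1, by omega⟩
  have hcop (k : ℕ) : IsCoprime ((p : ℤ) ^ k) 2 := by
    refine IsCoprime.pow_left ?_
    exact_mod_cast Nat.isCoprime_iff_coprime.2 hodd.coprime_two_right
  obtain ⟨c, hc⟩ := prime_dvd_coeff_risingProd (j := 2 * n + 4) hp (by omega) (by omega)
  obtain ⟨a', b', q', h'⟩ :=
    exists_two_mul_coeff_risingProd (n := 2 * n + 3) hodd ⟨n + 1, by ring⟩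
  obtain ⟨d, hd⟩ : (p : ℤ) ^ 2 ∣ (risingProd p).coeff (2 * n + 3) := by
    refine (hcop 2).dvd_of_dvd_mul_left ?_
    rw [h', show 2 * n + 3 + 1 = 2 * n + 4 from rfl, hc]
    refine ⟨(2 * n + 4) * c + a' * (risingProd p).coeff (2 * n + 5) +
      p * (b' * (risingProd p).coeff (2 * n + 6)) + p ^ 2 * q', ?_⟩
    push_cast
    ring
  obtain ⟨a, b, q, h⟩ := exists_two_mul_coeff_risingProd (n := 2 * n + 1) hodd ⟨n, rfl⟩
  rw [show 2 * n + 1 + 1 = 2 * n + 2 from rfl, show 2 * n + 1 + 2 = 2 * n + 3 from rfl,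
    show 2 * n + 1 + 3 = 2 * n + 4 from rfl, hc, hd] at h
  refine (hcop 4).dvd_of_dvd_mul_left ⟨a * d + b * c + q, ?_⟩
  rw [show 2 * (n + 1) - 1 = 2 * n + 1 by omega, show 2 * (n + 1) = 2 * n + 2 by ring]
  push_cast at h ⊢
  linear_combination h

theorem isPInteger_intCast_div_natCast {p n : ℕ} (hp : p.Prime) (hn : ¬ p ∣ n) (z : ℤ) :
    IsPInteger p ((z : ℚ) / n) := by
  have := Fact.mk hp
  unfold IsPInteger
  rcases eq_or_ne z 0 with rfl | hz
  · simp
  have hn0 : (n : ℚ) ≠ 0 := by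
    rintro h
    exact hn (by simp [Nat.cast_eq_zero.1 h])
  rw [padicValRat.div (Int.cast_ne_zero.2 hz) hn0, padicValRat.of_int, padicValRat.of_nat,
    padicValNat.eq_zero_of_not_dvd hn]
  simp

theorem H_combination_mod_p4 (p : ℕ) (hp : p.Prime) (hodd : Odd p)
    (m : ℕ) (hm : 1 ≤ m) (hm' : 2 * m + 1 ≠ p - 2) :
    PModEq p 4 (H p (2 * m - 1) - m * p * H p (2 * m)) 0 := by
  obtain ⟨z, hz⟩ := prime_pow_four_dvd_coeff_risingProd hp hodd hm hm'
  have hfac : ¬ p ∣ (p - 1).factorial := by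
    have := hp.pos
    rw [hp.dvd_factorial]
    omega
  have hp0 : (p : ℚ) ≠ 0 := Nat.cast_ne_zero.2 hp.ne_zero
  have hfac0 : ((p - 1).factorial : ℚ) ≠ 0 := Nat.cast_ne_zero.2 (Nat.factorial_ne_zero _)
  have hzq := congrArg (Int.cast : ℤ → ℚ) hz
  push_cast at hzq
  rw [coeff_risingProd, coeff_risingProd] at hzq
  have heq : (H p (2 * m - 1) - m * p * H p (2 * m) - 0) / (p : ℚ) ^ 4 =
      (z : ℚ) / (p - 1).factorial := by
    rw [div_eq_div_iff (pow_ne_zero 4 hp0) hfac0]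
    linear_combination hzq
  rw [PModEq, heq]
  exact isPInteger_intCast_div_natCast hp hfac z
end
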